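/- arXiv:2107.05182 — 2 statements merged into one kernel-verified Lean document; each statement's English description precedes it below -/
import Mathlib

section
/- Let p > 1, c > 0, μ > 0. Let u : ℝ → ℝ be a real-valued Schwartz function solving the pseudo-relativistic elliptic equation 𝓗_c u − |u|^{p−1}u = −μu, in the sense that for every ξ ∈ ℝ, (m_c(2πξ) + μ) û(ξ) = ∫_ℝ e^{−2πixξ} |u(x)|^{p−1}u(x) dx. Then the Pohozaev identity holds: (1/2)K_c(u) − ((p−1)/(2(p+1))) ∫_ℝ |u(x)|^{p+1} dx + (1/4) ∫_ℝ ( m_c(2πξ) / √(1/4 + (2πξ)²/c²) ) |û(ξ)|² dξ = 0. -/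
open Real MeasureTheory SchwartzMap FourierTransform

/-- The symbol of the pseudo-relativistic operator. -/
noncomputable def mSym (c ξ : ℝ) : ℝ := Real.sqrt (c ^ 2 * ξ ^ 2 + c ^ 4 / 4) - c ^ 2 / 2

/-- The relativistic kinetic energy `K_c(u)`. -/
noncomputable def kineticC (c : ℝ) (u : ℝ → ℂ) : ℝ :=
  ∫ ξ : ℝ, mSym c (2 * π * ξ) * ‖𝓕 u ξ‖ ^ 2


lemma intR {E : Type*} [NormedAddCommGroup E] [InnerProductSpace ℝ E]
    {w : ℝ → ℝ} (hw : Continuous w) {A : ℝ} (hA : ∀ x, |w x| ≤ A * (1 + |x|))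
    (F G : SchwartzMap ℝ E) : Integrable (fun x => w x * inner ℝ (F x) (G x)) := by
  have hB : ∀ x, ‖G x‖ ≤ SchwartzMap.seminorm ℝ 0 0 G := fun x => SchwartzMap.norm_le_seminorm ℝ G x
  set B := SchwartzMap.seminorm ℝ 0 0 G
  have h1 := ((F.integrable_pow_mul volume 0).add (F.integrable_pow_mul volume 1)).const_mul (A * B)
  refine h1.mono' (by have := F.continuous; have := G.continuous; fun_prop) ?_
  refine Filter.Eventually.of_forall fun x => ?_
  have hA' := (abs_nonneg _).trans (hA x)
  simp only [norm_mul, Real.norm_eq_abs, Pi.add_apply, pow_zero, one_mul, pow_one]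
  calc |w x| * |inner ℝ (F x) (G x)| ≤ (A * (1 + |x|)) * (‖F x‖ * B) := by
        apply mul_le_mul (hA x) _ (abs_nonneg _) hA'
        exact (abs_real_inner_le_norm _ _).trans (by gcongr; exact hB x)
    _ = _ := by ring

lemma fourier_conj (v : ℝ → ℝ) (ξ : ℝ) :
    𝓕⁻ (fun x => (v x : ℂ)) ξ = (starRingEnd ℂ) (𝓕 (fun x => (v x : ℂ)) ξ) := by
  rw [Real.fourierInv_eq_fourier_neg, Real.fourier_real_eq_integral_exp_smul,
    Real.fourier_real_eq_integral_exp_smul, ← integral_conj]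
  congr 1
  ext x
  simp [← Complex.exp_conj, Complex.conj_ofNat]

/-- complexification -/
noncomputable def cpl (v : SchwartzMap ℝ ℝ) : SchwartzMap ℝ ℂ :=
  v.postcompCLM (𝕜 := ℝ) Complex.ofRealCLM

lemma cpl_coe (v : SchwartzMap ℝ ℝ) : (cpl v : ℝ → ℂ) = fun x => (v x : ℂ) := rfl

lemma parsevalRe (g : ℝ → ℝ) (hg : Integrable g) (v : SchwartzMap ℝ ℝ) :
    ∫ x, g x * v x = ∫ ξ, inner ℝ (𝓕 (cpl v) ξ) (𝓕 (fun x => (g x : ℂ)) ξ) := by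
  have hgc : Integrable (fun x => (g x : ℂ)) := hg.ofReal
  have h := VectorFourier.integral_fourierIntegral_smul_eq_flip (L := innerₗ ℝ) (μ := volume)
    (ν := volume)
      Real.continuous_fourierChar continuous_inner hgc (𝓕⁻ (cpl v)).integrable
  have h' : ∫ ξ, 𝓕 (fun x => (g x : ℂ)) ξ * (𝓕⁻ (cpl v)) ξ
      = ∫ x, (g x : ℂ) * 𝓕 (𝓕⁻ (cpl v)) x := by
    rw [flip_innerₗ] at h
    exact h
  rw [FourierTransform.fourier_fourierInv_eq] at h'
  have hI : Integrable (fun ξ => 𝓕 (fun x => (g x : ℂ)) ξ * (𝓕⁻ (cpl v)) ξ) := by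
    refine (𝓕⁻ (cpl v)).integrable.bdd_mul (c := ∫ x, ‖(g x : ℂ)‖) ?_ ?_
    · exact (VectorFourier.fourierIntegral_continuous Real.continuous_fourierChar
        (L := innerₗ ℝ) continuous_inner hgc).aestronglyMeasurable
    · exact Filter.Eventually.of_forall fun ξ =>
        VectorFourier.norm_fourierIntegral_le_integral_norm _ _ _ _ _
  have h2 := congrArg Complex.re h'
  have e2 : ∫ x, (g x : ℂ) * cpl v x = ((∫ x, g x * v x : ℝ) : ℂ) := by
    rw [← integral_complex_ofReal]; simp [cpl_coe]
  rw [e2, Complex.ofReal_re] at h2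
  rw [← h2]
  have := integral_re hI
  simp only [RCLike.re_to_complex] at this
  rw [← this]
  congr 1
  ext ξ
  rw [Complex.inner, SchwartzMap.fourierInv_coe, cpl_coe, fourier_conj]
  rfl

lemma fourier_xderiv (u : SchwartzMap ℝ ℝ) (v : SchwartzMap ℝ ℝ) (hv : ∀ x, v x = x * deriv u x)
    (ξ : ℝ) :
    𝓕 (cpl v) ξ = - (𝓕 (cpl u) ξ + ξ * deriv (𝓕 (cpl u) : SchwartzMap ℝ ℂ) ξ) := by
  set f := cpl u
  have hD : ∀ x, SchwartzMap.derivCLM ℝ ℂ f x = ((deriv u x : ℝ) : ℂ) := by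
    intro x
    rw [SchwartzMap.derivCLM_apply]
    exact (u.differentiableAt.hasDerivAt (x := x)).ofReal_comp.deriv
  have h1 := Real.fourier_deriv f.integrable f.differentiable
    (SchwartzMap.derivCLM ℝ ℂ f).integrable
  have hv' : (fun x : ℝ => x • SchwartzMap.derivCLM ℝ ℂ f x) = cpl v := by
    ext x; simp only [hD, cpl_coe, hv]; simp
  have h2 := Real.hasDerivAt_fourier (SchwartzMap.derivCLM ℝ ℂ f).integrable
    (by rw [hv']; exact (cpl v).integrable) ξ
  have e : (fun x : ℝ => (-2 * π * Complex.I * x) • SchwartzMap.derivCLM ℝ ℂ f x)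
    = (-2 * π * Complex.I) • (cpl v : ℝ → ℂ) := by
    rw [← hv']; ext x; simp; ring
  rw [e] at h2
  have h3 : HasDerivAt (fun x : ℝ => (2 * π * Complex.I * x) • (𝓕 (f : ℝ → ℂ) x))
      ((2 * π * Complex.I) * 𝓕 (f : ℝ → ℂ) ξ + (2 * π * Complex.I * ξ) * deriv (𝓕 f : SchwartzMap ℝ ℂ) ξ) ξ := by
    have ha : HasDerivAt (fun x : ℝ => (2 * π * Complex.I * x)) (2 * π * Complex.I) ξ := by
      simpa using ((hasDerivAt_id ξ).ofReal_comp).const_mul (2 * π * Complex.I)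
    exact ha.mul ((𝓕 f).differentiableAt.hasDerivAt (x := ξ))
  rw [← h1] at h3
  have h4 := h2.unique h3
  have h5 : 𝓕 ((-2 * π * Complex.I) • (cpl v : ℝ → ℂ)) ξ
      = (-2 * π * Complex.I) * 𝓕 (cpl v : ℝ → ℂ) ξ := by
    rw [Real.fourier_real_eq_integral_exp_smul, Real.fourier_real_eq_integral_exp_smul,
      ← integral_const_mul]
    congr 1
    ext x
    simp only [Pi.smul_apply, smul_eq_mul]
    ring
  rw [h5] at h4
  change 𝓕 (cpl v : ℝ → ℂ) ξ = - (𝓕 (f : ℝ → ℂ) ξ + _)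
  have hpi : (2 * π * Complex.I : ℂ) ≠ 0 := by simp [Real.pi_ne_zero]
  apply mul_left_cancel₀ hpi
  linear_combination -h4

lemma mSym_facts (c : ℝ) (hc : 0 < c) (η : ℝ) :
    0 ≤ mSym c η ∧ mSym c η ≤ c * |η| ∧
    HasDerivAt (mSym c) (c ^ 2 * η / Real.sqrt (c ^ 2 * η ^ 2 + c ^ 4 / 4)) η ∧
    η * (c ^ 2 * η / Real.sqrt (c ^ 2 * η ^ 2 + c ^ 4 / 4)) =
      mSym c η + (1 / 2) * (mSym c η / Real.sqrt (1 / 4 + η ^ 2 / c ^ 2)) ∧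
    1 / 2 ≤ Real.sqrt (1 / 4 + η ^ 2 / c ^ 2) := by
  have hpos : 0 < c ^ 2 * η ^ 2 + c ^ 4 / 4 := by positivity
  have hS := Real.sq_sqrt hpos.le
  have hS0 := Real.sqrt_pos.2 hpos
  have hR : Real.sqrt (c ^ 2 * η ^ 2 + c ^ 4 / 4) = c ^ 2 * Real.sqrt (1 / 4 + η ^ 2 / c ^ 2) := by
    rw [Real.sqrt_eq_iff_mul_self_eq hpos.le (by positivity)]
    rw [mul_mul_mul_comm, Real.mul_self_sqrt (by positivity)]
    field_simp
    ring
  refine ⟨?_, ?_, ?_, ?_, ?_⟩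
  · unfold mSym
    rw [sub_nonneg]
    apply Real.le_sqrt_of_sq_le
    nlinarith [sq_nonneg (c * η)]
  · unfold mSym
    rw [sub_le_iff_le_add]
    apply Real.sqrt_le_iff.2
    constructor
    · positivity
    · have : 0 ≤ c * |η| * c ^ 2 := by positivity
      nlinarith [sq_abs η]
  · unfold mSym
    have h1 : HasDerivAt (fun ξ : ℝ => c ^ 2 * ξ ^ 2 + c ^ 4 / 4) (c ^ 2 * (2 * η)) η := by
      simpa using ((hasDerivAt_pow 2 η).const_mul (c ^ 2)).add_const (c ^ 4 / 4)
    convert! (h1.sqrt hpos.ne').sub_const (c ^ 2 / 2) using 1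
    field_simp
  · unfold mSym
    rw [hR] at hS hS0 ⊢
    set R := Real.sqrt (1 / 4 + η ^ 2 / c ^ 2)
    have hR0 : 0 < R := by positivity
    have : c ^ 2 * R ^ 2 = η ^ 2 + c ^ 2 / 4 := by
      have h2 : c ^ 2 * (c ^ 2 * R ^ 2) = c ^ 2 * (η ^ 2 + c ^ 2 / 4) := by linarith
      exact mul_left_cancel₀ (by positivity) h2
    field_simp
    linarith
  · apply Real.le_sqrt_of_sq_le
    have : 0 ≤ η ^ 2 / c ^ 2 := by positivity
    linarith

/-- x times a Schwartz function -/
noncomputable def mulX {E : Type*} [NormedAddCommGroup E] [NormedSpace ℝ E]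
    (F : SchwartzMap ℝ E) : SchwartzMap ℝ E :=
  SchwartzMap.smulLeftCLM E (fun x : ℝ => x) F

lemma mulX_apply {E : Type*} [NormedAddCommGroup E] [NormedSpace ℝ E]
    (F : SchwartzMap ℝ E) (x : ℝ) : mulX F x = x • F x :=
  SchwartzMap.smulLeftCLM_apply_apply (by fun_prop) F x

/-- Integration by parts. -/
lemma ibp (F : SchwartzMap ℝ ℂ) (w w' : ℝ → ℝ) (A : ℝ) (hw : ∀ x, HasDerivAt w (w' x) x)
    (hA : ∀ x, |w x| ≤ A * (1 + |x|)) (hc : Continuous w')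
    (hA' : ∀ x, |x * w' x| ≤ A * (1 + |x|)) :
    (∫ x, w x * ‖F x‖ ^ 2) + (∫ x, x * w' x * ‖F x‖ ^ 2)
      + 2 * (∫ x, w x * inner ℝ (F x) (mulX (SchwartzMap.derivCLM ℝ ℂ F) x)) = 0 := by
  have hwc : Continuous w := continuous_iff_continuousAt.2 fun x => (hw x).continuousAt
  have i1 : Integrable (fun x => w x * ‖F x‖ ^ 2) := by
    simpa only [real_inner_self_eq_norm_sq] using intR hwc hA F F
  have i2 : Integrable (fun x => x * w' x * ‖F x‖ ^ 2) := by
    simpa only [real_inner_self_eq_norm_sq] using intR (by fun_prop) hA' F F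
  have i3 := intR hwc hA F (mulX (SchwartzMap.derivCLM ℝ ℂ F))
  have i4 : Integrable (fun x => x * w x * ‖F x‖ ^ 2) := by
    refine (intR hwc hA F (mulX F)).congr (Filter.Eventually.of_forall fun x => ?_)
    simp only [mulX_apply, real_inner_smul_right, real_inner_self_eq_norm_sq]
    ring
  have h := integral_eq_zero_of_hasDerivAt_of_integrable
    (f := fun x => x * w x * ‖F x‖ ^ 2)
    (f' := fun x => w x * ‖F x‖ ^ 2 + x * w' x * ‖F x‖ ^ 2
      + 2 * (w x * inner ℝ (F x) (mulX (SchwartzMap.derivCLM ℝ ℂ F) x)))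
    (fun x => by
      have h1 := (F.differentiableAt.hasDerivAt (x := x)).norm_sq
      convert! ((hasDerivAt_id x).mul (hw x)).mul h1 using 1
      simp only [mulX_apply, real_inner_smul_right, SchwartzMap.derivCLM_apply, id]
      simp only [Pi.mul_apply, id]
      ring)
    ((i1.add i2).add (i3.const_mul 2)) i4
  rw [integral_add (by exact i1.add i2) (i3.const_mul 2), integral_add i1 i2, integral_const_mul] at h
  exact h

theorem relativistic_pohozaev (p c μ : ℝ) (hp : 1 < p) (hc : 0 < c) (hμ : 0 < μ)
    (u : SchwartzMap ℝ ℝ)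
    (heq : ∀ ξ : ℝ,
      ((mSym c (2 * π * ξ) + μ : ℝ) : ℂ) * 𝓕 (fun x : ℝ => (u x : ℂ)) ξ
        = 𝓕 (fun x : ℝ => ((|u x| ^ (p - 1) * u x : ℝ) : ℂ)) ξ) :
    (1 / 2) * kineticC c (fun x : ℝ => (u x : ℂ))
        - (p - 1) / (2 * (p + 1)) * (∫ x : ℝ, |u x| ^ (p + 1))
        + (1 / 4) * (∫ ξ : ℝ,
            mSym c (2 * π * ξ) / Real.sqrt (1 / 4 + (2 * π * ξ) ^ 2 / c ^ 2)
              * ‖𝓕 (fun x : ℝ => (u x : ℂ)) ξ‖ ^ 2)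
      = 0 := by
  unfold kineticC
  set F : SchwartzMap ℝ ℂ := 𝓕 (cpl u) with hF
  have hFc : 𝓕 (fun x : ℝ => (u x : ℂ)) = F := rfl
  rw [hFc]
  simp only [hFc] at heq
  -- the nonlinearity
  have huc := u.continuous
  have hac : Continuous (fun x => |u x| ^ (p - 1)) :=
    huc.abs.rpow_const (fun x => Or.inr (by linarith))
  obtain ⟨M, hM⟩ : ∃ M : ℝ, ∀ x, |(|u x| ^ (p - 1))| ≤ M := by
    refine ⟨(SchwartzMap.seminorm ℝ 0 0 u) ^ (p - 1), fun x => ?_⟩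
    rw [abs_of_nonneg (by positivity)]
    exact Real.rpow_le_rpow (abs_nonneg _) (SchwartzMap.norm_le_seminorm ℝ u x) (by linarith)
  have hM' : ∀ x, |(|u x| ^ (p - 1))| ≤ M * (1 + |x|) := fun x => by
    have := hM x
    have h0 := (abs_nonneg _).trans this
    nlinarith [abs_nonneg x]
  have hg : Integrable (fun x => |u x| ^ (p - 1) * u x) :=
    u.integrable.bdd_mul hac.aestronglyMeasurable (Filter.Eventually.of_forall hM)
  have hpow : ∀ x, |u x| ^ (p + 1) = |u x| ^ (p - 1) * u x * u x := fun x => by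
    rcases eq_or_ne (u x) 0 with h | h
    · rw [h]; simp [Real.zero_rpow (by linarith : p + 1 ≠ 0)]
    · rw [show p + 1 = (p - 1) + 2 by ring, Real.rpow_add (abs_pos.2 h)]
      norm_num
      ring
  set v : SchwartzMap ℝ ℝ := mulX (SchwartzMap.derivCLM ℝ ℝ u) with hvdef
  have hv : ∀ x, v x = x * deriv u x := fun x => by
    rw [hvdef, mulX_apply, SchwartzMap.derivCLM_apply, smul_eq_mul]
  -- physical side
  have hPJ : (∫ x, |u x| ^ (p + 1)) + (p + 1) * (∫ x, |u x| ^ (p - 1) * u x * v x) = 0 := by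
    have i1 : Integrable (fun x => |u x| ^ (p + 1)) := by
      refine (intR hac hM' u u).congr (Filter.Eventually.of_forall fun x => ?_)
      simp only [hpow, RCLike.inner_apply, conj_trivial]; ring
    have i2 : Integrable (fun x => |u x| ^ (p - 1) * u x * v x) := by
      refine (intR hac hM' u v).congr (Filter.Eventually.of_forall fun x => ?_)
      simp only [RCLike.inner_apply, conj_trivial]; ring
    have i3 : Integrable (fun x => x * |u x| ^ (p + 1)) := by
      refine (intR hac hM' u (mulX u)).congr (Filter.Eventually.of_forall fun x => ?_)
      simp only [hpow, mulX_apply, RCLike.inner_apply, conj_trivial, smul_eq_mul]; ring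
    have h := integral_eq_zero_of_hasDerivAt_of_integrable
      (f := fun x => x * |u x| ^ (p + 1))
      (f' := fun x => |u x| ^ (p + 1) + (p + 1) * (|u x| ^ (p - 1) * u x * v x))
      (fun x => by
        have h1 := (hasDerivAt_abs_rpow (u x) (p := p + 1) (by linarith)).comp x
          (u.differentiableAt.hasDerivAt (x := x))
        convert! (hasDerivAt_id x).mul h1 using 1
        simp only [hv, id, Function.comp]
        rw [show p + 1 - 2 = p - 1 by ring]
        ring)
      (i1.add (i2.const_mul _)) i3
    rwa [integral_add i1 (i2.const_mul _), integral_const_mul] at h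
  -- Fourier side
  set w : ℝ → ℝ := fun ξ => mSym c (2 * π * ξ) + μ with hw
  set w' : ℝ → ℝ := fun ξ => (c ^ 2 * (2 * π * ξ) /
    Real.sqrt (c ^ 2 * (2 * π * ξ) ^ 2 + c ^ 4 / 4)) * (2 * π) with hw'
  have hwd : ∀ ξ, HasDerivAt w (w' ξ) ξ := fun ξ => by
    have h1 : HasDerivAt (fun ξ : ℝ => 2 * π * ξ) (2 * π) ξ := by
      simpa using (hasDerivAt_id ξ).const_mul (2 * π)
    exact ((mSym_facts c hc (2 * π * ξ)).2.2.1.comp ξ h1).add_const μ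
  have hmc : Continuous (fun ξ => mSym c (2 * π * ξ)) := by unfold mSym; fun_prop
  have hwc : Continuous w := hmc.add continuous_const
  have hwc' : Continuous w' := by
    refine Continuous.mul (Continuous.div (by fun_prop) (by fun_prop) fun ξ => ?_) continuous_const
    have : 0 < c ^ 2 * (2 * π * ξ) ^ 2 + c ^ 4 / 4 := by positivity
    exact (Real.sqrt_pos.2 this).ne'
  set T : ℝ → ℝ := fun ξ => mSym c (2 * π * ξ) / Real.sqrt (1 / 4 + (2 * π * ξ) ^ 2 / c ^ 2) with hT
  have hTc : Continuous T := by
    refine Continuous.div hmc (by fun_prop) fun ξ => ?_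
    have := (mSym_facts c hc (2 * π * ξ)).2.2.2.2
    linarith
  have hs : ∀ ξ, ξ * w' ξ = mSym c (2 * π * ξ) + (1 / 2) * T ξ := fun ξ => by
    rw [← (mSym_facts c hc (2 * π * ξ)).2.2.2.1]
    simp only [hw']; ring
  have hmb : ∀ ξ, |mSym c (2 * π * ξ)| ≤ (4 * π * c + μ) * (1 + |ξ|) := fun ξ => by
    obtain ⟨h0, h1, -⟩ := mSym_facts c hc (2 * π * ξ)
    rw [abs_of_nonneg h0]
    rw [abs_mul, abs_of_pos (by positivity : 0 < 2 * π)] at h1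
    have : 0 ≤ π * c * |ξ| := by positivity
    have : 0 ≤ μ * |ξ| := by positivity
    have : 0 ≤ π * c := by positivity
    nlinarith
  have hwb : ∀ ξ, |w ξ| ≤ (4 * π * c + μ) * (1 + |ξ|) := fun ξ => by
    obtain ⟨h0, h1, -⟩ := mSym_facts c hc (2 * π * ξ)
    rw [abs_of_nonneg (add_nonneg h0 hμ.le)]
    rw [abs_mul, abs_of_pos (by positivity : 0 < 2 * π)] at h1
    have : 0 ≤ π * c * |ξ| := by positivity
    have : 0 ≤ μ * |ξ| := by positivity
    have : 0 ≤ π * c := by positivity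
    change mSym c (2 * π * ξ) + μ ≤ _
    nlinarith
  have hTb0 : ∀ ξ, 0 ≤ T ξ ∧ T ξ ≤ 2 * mSym c (2 * π * ξ) := fun ξ => by
    obtain ⟨h0, -, -, -, h2⟩ := mSym_facts c hc (2 * π * ξ)
    refine ⟨by positivity, ?_⟩
    simp only [hT]
    rw [div_le_iff₀ (by linarith)]
    nlinarith
  have hsb : ∀ ξ, |ξ * w' ξ| ≤ (4 * π * c + μ) * (1 + |ξ|) := fun ξ => by
    obtain ⟨h0, h1, -⟩ := mSym_facts c hc (2 * π * ξ)
    obtain ⟨h3, h4⟩ := hTb0 ξ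
    rw [hs, abs_of_nonneg (by positivity)]
    rw [abs_mul, abs_of_pos (by positivity : 0 < 2 * π)] at h1
    have : 0 ≤ π * c * |ξ| := by positivity
    have : 0 ≤ μ * |ξ| := by positivity
    have : 0 ≤ π * c := by positivity
    nlinarith
  have hTb : ∀ ξ, |T ξ| ≤ (2 * (4 * π * c + μ)) * (1 + |ξ|) := fun ξ => by
    obtain ⟨h3, h4⟩ := hTb0 ξ
    have := (le_abs_self _).trans (hmb ξ)
    rw [abs_of_nonneg h3]
    linarith
  have hI := ibp F w w' _ hwd hwb hwc' hsb
  have hS : (∫ x, x * w' x * ‖F x‖ ^ 2) = (∫ ξ, mSym c (2 * π * ξ) * ‖F ξ‖ ^ 2)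
      + (1 / 2) * ∫ ξ, T ξ * ‖F ξ‖ ^ 2 := by
    have i1 := intR hmc hmb F F
    have i2 := intR hTc hTb F F
    simp only [real_inner_self_eq_norm_sq] at i1 i2
    rw [← integral_const_mul, ← integral_add i1 (i2.const_mul _)]
    congr 1
    ext ξ
    rw [hs]; ring
  have hP1 : (∫ x, |u x| ^ (p + 1)) = ∫ ξ, w ξ * ‖F ξ‖ ^ 2 := by
    simp only [hpow]
    rw [parsevalRe _ hg u]
    congr 1
    ext ξ
    rw [← heq ξ, ← Complex.real_smul, real_inner_smul_right, ← hF, real_inner_self_eq_norm_sq]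
  have hJ1 : (∫ x, |u x| ^ (p - 1) * u x * v x) = -(∫ ξ, w ξ * ‖F ξ‖ ^ 2)
      - ∫ ξ, w ξ * inner ℝ (F ξ) (mulX (SchwartzMap.derivCLM ℝ ℂ F) ξ) := by
    have i1 := intR hwc hwb F F
    have i2 := intR hwc hwb F (mulX (SchwartzMap.derivCLM ℝ ℂ F))
    simp only [real_inner_self_eq_norm_sq] at i1
    rw [parsevalRe _ hg v, ← integral_neg, ← integral_sub (by exact i1.neg) i2]
    congr 1
    ext ξ
    rw [← heq ξ, ← Complex.real_smul, real_inner_smul_right, fourier_xderiv u v hv ξ, ← hF,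
      inner_neg_left, inner_add_left, real_inner_self_eq_norm_sq, mulX_apply,
      SchwartzMap.derivCLM_apply, Complex.real_smul, real_inner_comm]
    ring
  have hp1 : p + 1 ≠ 0 := by linarith
  rw [hS, ← hP1] at hI
  rw [← hP1] at hJ1
  rw [hJ1] at hPJ
  generalize (∫ x, |u x| ^ (p + 1)) = P at *
  change (1 / 2) * (∫ ξ, mSym c (2 * π * ξ) * ‖F ξ‖ ^ 2) - (p - 1) / (2 * (p + 1)) * P
    + (1 / 4) * (∫ ξ, T ξ * ‖F ξ‖ ^ 2) = 0
  have e : (p + 1) * ((p - 1) / (2 * (p + 1))) = (p - 1) / 2 := by field_simp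
  apply mul_left_cancel₀ hp1
  linear_combination -P * e + hPJ + (p + 1) / 2 * hI
end

section
/- Let p > 1, c > 0, μ > 0. Let u : ℝ → ℝ be a real-valued Schwartz function solving the pseudo-relativistic elliptic equation 𝓗_c u − |u|^{p−1}u = −μu, in the sense that for every ξ ∈ ℝ, (m_c(2πξ) + μ) û(ξ) = ∫_ℝ e^{−2πixξ} |u(x)|^{p−1}u(x) dx. Then 𝓔_c(u) = ((p−3)/(2(p−1))) K_c(u) − (c²/(2(p−1))) ∫_ℝ |u|² + (c⁴/(4(p−1))) ∫_ℝ |û(ξ)|² / √(c²(2πξ)² + c⁴/4) dξ. In particular, if p ∈ (3,5) then 𝓔_c(u) ≥ ((p−3)/(2(p−1))) K_c(u) − (c²/(2(p−1))) ∫_ℝ |u|². -/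
open Real MeasureTheory SchwartzMap FourierTransform

/-- The relativistic energy `𝓔_c(u)`. -/
noncomputable def energyC (c p : ℝ) (u : ℝ → ℂ) : ℝ :=
  (1 / 2) * kineticC c u - (1 / (p + 1)) * ∫ x : ℝ, ‖u x‖ ^ (p + 1)

lemma aux_integrable {E V : Type*} [NormedAddCommGroup E]
    [NormedAddCommGroup V] [NormedSpace ℝ V] (φ : SchwartzMap ℝ V) (F : ℝ → E)
    (hF : Continuous F) (A B : ℝ) (h : ∀ x, ‖F x‖ ≤ (A + B * |x| ^ 2) * ‖φ x‖) :
    Integrable F := by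
  have h0 := (φ.integrable_pow_mul volume 0).const_mul A
  have h2 := (φ.integrable_pow_mul volume 2).const_mul B
  refine (h0.add h2).mono' hF.aestronglyMeasurable (Filter.Eventually.of_forall fun x => ?_)
  refine (h x).trans (le_of_eq ?_)
  simp only [Pi.add_apply, Real.norm_eq_abs, pow_zero]
  ring

lemma aux_bdd {E : Type*} [NormedAddCommGroup E] [NormedSpace ℝ E] (φ : SchwartzMap ℝ E) :
    ∃ W, 0 ≤ W ∧ ∀ x, ‖φ x‖ ≤ W := by
  refine ⟨‖φ.toBoundedContinuousFunction‖, norm_nonneg _, fun x => ?_⟩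
  exact φ.toBoundedContinuousFunction.norm_coe_le_norm x

/-- the multiplication by x -/
noncomputable def xMul (f : SchwartzMap ℝ ℂ) : SchwartzMap ℝ ℂ :=
  SchwartzMap.smulLeftCLM ℂ (fun x : ℝ => x) f

lemma xMul_apply (f : SchwartzMap ℝ ℂ) (x : ℝ) : xMul f x = (x : ℂ) * f x := by
  unfold xMul
  rw [SchwartzMap.smulLeftCLM_apply_apply (by fun_prop)]
  simp

/-- `x f'` -/
noncomputable def xD (f : SchwartzMap ℝ ℂ) : SchwartzMap ℝ ℂ :=
  SchwartzMap.derivCLM ℂ ℂ (xMul f) - f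

lemma xD_apply (f : SchwartzMap ℝ ℂ) (x : ℝ) : xD f x = (x : ℂ) * deriv f x := by
  have h : HasDerivAt (xMul f) (1 * f x + (x : ℂ) * deriv f x) x := by
    have e : (xMul f : ℝ → ℂ) = fun x : ℝ => (x : ℂ) * f x := funext (xMul_apply f)
    rw [e]
    exact (Complex.ofRealCLM.hasDerivAt (x := x)).mul f.differentiableAt.hasDerivAt
  have : xD f x = deriv (xMul f) x - f x := rfl
  rw [this, h.deriv]
  ring

lemma xD_fourier (f : SchwartzMap ℝ ℂ) (ξ : ℝ) :
    𝓕 (xD f) ξ = - 𝓕 f ξ - (ξ : ℂ) * deriv (𝓕 f : SchwartzMap ℝ ℂ) ξ := by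
  have e : 𝓕 (xD f) = 𝓕 (SchwartzMap.derivCLM ℂ ℂ (xMul f)) - 𝓕 f := by
    unfold xD
    exact map_sub (SchwartzMap.fourierTransformCLM ℂ) _ _
  have h1 : 𝓕 (SchwartzMap.derivCLM ℂ ℂ (xMul f)) ξ = (2 * π * Complex.I * ξ) • 𝓕 (xMul f) ξ := by
    have := congrFun (Real.fourier_deriv (xMul f).integrable (xMul f).differentiable
      (SchwartzMap.derivCLM ℂ ℂ (xMul f)).integrable) ξ
    exact this
  have hx : (fun x : ℝ => x • f x) = xMul f := by
    ext x; rw [xMul_apply]; simp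
  have h2 := (Real.hasDerivAt_fourier f.integrable (by rw [hx]; exact (xMul f).integrable) ξ).deriv
  have h3 : (fun x : ℝ ↦ (-2 * π * Complex.I * x) • f x)
      = ((-2 * π * Complex.I) • xMul f : SchwartzMap ℝ ℂ) := by
    ext x; simp [xMul_apply]; ring
  rw [h3] at h2
  have h4 : 𝓕 ((-2 * π * Complex.I) • xMul f : SchwartzMap ℝ ℂ)
      = (-2 * π * Complex.I) • 𝓕 (xMul f) :=
    map_smul (SchwartzMap.fourierTransformCLM ℂ) _ _
  have h5 : deriv (𝓕 f : SchwartzMap ℝ ℂ) ξ = (-2 * π * Complex.I) • 𝓕 (xMul f) ξ := by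
    refine Eq.trans h2 ?_
    exact congrArg (fun k : SchwartzMap ℝ ℂ => k ξ) h4
  rw [e, h5]
  simp only [sub_apply, h1, smul_eq_mul]
  ring

lemma pairing (g : ℝ → ℂ) (hg : Integrable g) (φ : SchwartzMap ℝ ℂ) :
    ∫ ξ, inner ℂ (𝓕 g ξ) (𝓕 φ ξ) = ∫ x, inner ℂ (g x) (φ x) := by
  have := VectorFourier.integral_sesq_fourierIntegral_eq_neg_flip (innerSL ℂ (E := ℂ))
    (L := innerₗ ℝ) (μ := volume) (ν := volume) (f := g) (g := (𝓕 φ : SchwartzMap ℝ ℂ))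
    continuous_fourierChar continuous_inner hg (𝓕 φ).integrable
  have e : ∀ x, φ x = VectorFourier.fourierIntegral 𝐞 volume (-(innerₗ ℝ).flip)
      (𝓕 φ : SchwartzMap ℝ ℂ) x := by
    intro x
    have h : 𝓕⁻ (𝓕 φ) = φ := FourierTransform.fourierInv_fourier_eq φ
    conv_lhs => rw [← h]
    rw [SchwartzMap.fourierInv_coe]
    simp [Real.fourierInv_eq, VectorFourier.fourierIntegral]
  simp only [e]
  exact this

lemma abs_le_one_add_sq (x : ℝ) : |x| ≤ 1 + |x| ^ 2 := by nlinarith [sq_nonneg (|x| - 1 / 2)]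

lemma g_integrable (p : ℝ) (hp : 1 < p) (u : SchwartzMap ℝ ℝ) :
    Integrable (fun x => |u x| ^ (p - 1) * u x) := by
  obtain ⟨U, hU0, hU⟩ := aux_bdd u
  have hc : Continuous u := u.continuous
  refine aux_integrable u _ ?_ (U ^ (p - 1)) 0 fun x => ?_
  · exact (hc.abs.rpow_const fun x => Or.inr (by linarith)).mul hc
  · have h1 : |u x| ^ (p - 1) ≤ U ^ (p - 1) :=
      Real.rpow_le_rpow (abs_nonneg _) (hU x) (by linarith)
    rw [norm_mul, Real.norm_of_nonneg (Real.rpow_nonneg (abs_nonneg _) _)]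
    have := norm_nonneg (u x)
    simp only [zero_mul, add_zero]
    gcongr

lemma pohozaev_real (p : ℝ) (hp : 1 < p) (u : SchwartzMap ℝ ℝ) :
    ∫ x, (|u x| ^ (p - 1) * u x) * (x * deriv u x) = - (1 / (p + 1)) * ∫ x, |u x| ^ (p + 1) := by
  obtain ⟨U, hU0, hU⟩ := aux_bdd u
  have hc : Continuous u := u.continuous
  have hc' : Continuous (deriv u) := (SchwartzMap.derivCLM ℝ ℝ u).continuous
  have hpc : ∀ q : ℝ, 0 < q → Continuous (fun x => |u x| ^ q) := fun q hq =>
    hc.abs.rpow_const fun x => Or.inr hq.le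
  have hb : ∀ x, |u x| ^ p ≤ U ^ p := fun x =>
      Real.rpow_le_rpow (abs_nonneg _) (hU x) (by linarith)
  have hUp : 0 ≤ U ^ p := Real.rpow_nonneg hU0 _
  have e1 : ∀ x, |u x| ^ (p + 1) = |u x| ^ p * |u x| := fun x =>
    Real.rpow_add_one' (abs_nonneg _) (by linarith)
  have e2 : ∀ x, |u x| ^ p = |u x| ^ (p - 1) * |u x| := fun x => by
    rw [← Real.rpow_add_one' (abs_nonneg _) (by linarith)]; congr 1; ring
  have i1 : Integrable (fun x => |u x| ^ (p + 1)) := by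
    refine aux_integrable u _ (hpc _ (by linarith)) (U ^ p) 0 fun x => ?_
    rw [Real.norm_of_nonneg (Real.rpow_nonneg (abs_nonneg _) _), e1]
    simp only [zero_mul, add_zero]
    exact mul_le_mul_of_nonneg_right (hb x) (abs_nonneg _)
  have i2 : Integrable (fun x => x * |u x| ^ (p + 1)) := by
    refine aux_integrable u _ (continuous_id.mul (hpc _ (by linarith))) (U ^ p) (U ^ p) fun x => ?_
    rw [norm_mul, Real.norm_of_nonneg (Real.rpow_nonneg (abs_nonneg _) _), e1,
      Real.norm_eq_abs, Real.norm_eq_abs]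
    calc |x| * (|u x| ^ p * |u x|) ≤ (1 + |x| ^ 2) * (U ^ p * |u x|) := by
          have := abs_le_one_add_sq x
          have := hb x
          gcongr
      _ = _ := by ring
  have i3 : Integrable (fun x => (|u x| ^ (p - 1) * u x) * (x * deriv u x)) := by
    refine aux_integrable (SchwartzMap.derivCLM ℝ ℝ u) _
      (((hpc _ (by linarith)).mul hc).mul (continuous_id.mul hc')) (U ^ p) (U ^ p) fun x => ?_
    rw [norm_mul, norm_mul, norm_mul, Real.norm_of_nonneg (Real.rpow_nonneg (abs_nonneg _) _),
      Real.norm_eq_abs (u x), ← e2, SchwartzMap.derivCLM_apply, Real.norm_eq_abs]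
    calc |u x| ^ p * (|x| * ‖deriv u x‖) ≤ U ^ p * ((1 + |x| ^ 2) * ‖deriv u x‖) := by
          have := abs_le_one_add_sq x
          have := hb x
          gcongr
      _ = _ := by ring
  have hd : ∀ x, HasDerivAt (fun x => x * |u x| ^ (p + 1))
      (|u x| ^ (p + 1) + (p + 1) * ((|u x| ^ (p - 1) * u x) * (x * deriv u x))) x := by
    intro x
    have h1 := (hasDerivAt_abs_rpow (u x) (p := p + 1) (by linarith)).comp x
      (u.differentiableAt (x := x)).hasDerivAt
    have h2 := (hasDerivAt_id x).mul h1
    convert! h2 using 1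
    have : p + 1 - 2 = p - 1 := by ring
    simp only [id, Function.comp, this]
    ring
  have := integral_eq_zero_of_hasDerivAt_of_integrable hd (i1.add (i3.const_mul (p + 1))) i2
  rw [integral_add i1 (i3.const_mul (p + 1)), integral_const_mul] at this
  have hp1 : p + 1 ≠ 0 := by linarith
  generalize (∫ x, (|u x| ^ (p - 1) * u x) * (x * deriv u x)) = a at *
  field_simp
  linarith

lemma mSym_nonneg (c ξ : ℝ) : 0 ≤ mSym c ξ := by
  unfold mSym
  have : c ^ 2 / 2 ≤ √(c ^ 2 * ξ ^ 2 + c ^ 4 / 4) := by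
    apply Real.le_sqrt_of_sq_le
    nlinarith [mul_nonneg (sq_nonneg c) (sq_nonneg ξ)]
  linarith

lemma mSym_le (c ξ : ℝ) (hc : 0 < c) : mSym c ξ ≤ c * |ξ| := by
  unfold mSym
  have : √(c ^ 2 * ξ ^ 2 + c ^ 4 / 4) ≤ c * |ξ| + c ^ 2 / 2 := by
    apply Real.sqrt_le_iff.2
    constructor
    · positivity
    · have := sq_abs ξ
      have : 0 ≤ c ^ 3 * |ξ| := by positivity
      nlinarith
  linarith

lemma mSym_hasDerivAt (c ξ : ℝ) (hc : 0 < c) :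
    HasDerivAt (fun ξ => mSym c (2 * π * ξ))
      (c ^ 2 * (2 * π) ^ 2 * ξ / √(c ^ 2 * (2 * π * ξ) ^ 2 + c ^ 4 / 4)) ξ := by
  unfold mSym
  have h0 : 0 < c ^ 2 * (2 * π * ξ) ^ 2 + c ^ 4 / 4 := by positivity
  have h1 : HasDerivAt (fun ξ : ℝ => c ^ 2 * (2 * π * ξ) ^ 2 + c ^ 4 / 4)
      (c ^ 2 * (2 * (2 * π * ξ) * (2 * π))) ξ := by
    have := ((((hasDerivAt_id ξ).const_mul (2 * π)).pow 2).const_mul (c ^ 2)).add_const (c ^ 4 / 4)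
    convert! this using 1
    simp
  have h2 := (h1.sqrt h0.ne').sub_const (c ^ 2 / 2)
  convert! h2 using 1
  have := Real.sqrt_pos.2 h0
  field_simp

lemma mSym_continuous (c : ℝ) : Continuous (fun ξ => mSym c (2 * π * ξ)) := by
  unfold mSym; fun_prop

lemma M_bound (c μ : ℝ) (hc : 0 < c) (hμ : 0 < μ) (ξ : ℝ) :
    |mSym c (2 * π * ξ) + μ| ≤ c * (2 * π) * |ξ| + μ := by
  have h1 := mSym_nonneg c (2 * π * ξ)
  have h2 := mSym_le c (2 * π * ξ) hc
  rw [abs_mul, abs_of_pos (show 0 < 2 * π by positivity)] at h2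
  rw [abs_of_nonneg (by linarith)]
  linarith

lemma MN_integrable (c μ : ℝ) (hc : 0 < c) (hμ : 0 < μ) (w v : SchwartzMap ℝ ℂ)
    (B : ℂ → ℂ → ℝ) (hB : Continuous fun z : ℂ × ℂ => B z.1 z.2)
    (hB' : ∀ a b, |B a b| ≤ ‖a‖ * ‖b‖) :
    Integrable (fun ξ => (mSym c (2 * π * ξ) + μ) * B (w ξ) (v ξ)) ∧
    Integrable (fun ξ => (mSym c (2 * π * ξ) + μ) * (ξ * B (w ξ) (v ξ))) := by
  obtain ⟨W, hW0, hW⟩ := aux_bdd w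
  have hBc : Continuous (fun ξ => B (w ξ) (v ξ)) :=
    hB.comp (w.continuous.prodMk v.continuous)
  have hM : Continuous (fun ξ => mSym c (2 * π * ξ) + μ) := (mSym_continuous c).add continuous_const
  have hpi := Real.pi_pos
  have hbb : ∀ ξ, |B (w ξ) (v ξ)| ≤ W * ‖v ξ‖ := fun ξ =>
    (hB' _ _).trans (mul_le_mul_of_nonneg_right (hW ξ) (norm_nonneg _))
  constructor
  · refine aux_integrable v _ (hM.mul hBc) ((c * (2 * π) + μ) * W) (c * (2 * π) * W) fun ξ => ?_
    rw [norm_mul, Real.norm_eq_abs, Real.norm_eq_abs]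
    calc _ ≤ (c * (2 * π) * (1 + |ξ| ^ 2) + μ) * (W * ‖v ξ‖) := by
          refine mul_le_mul ((M_bound c μ hc hμ ξ).trans ?_) (hbb ξ) (abs_nonneg _) (by positivity)
          have := abs_le_one_add_sq ξ
          gcongr
      _ = _ := by ring
  · refine aux_integrable v _ (hM.mul (continuous_id.mul hBc)) (μ * W)
      ((c * (2 * π) + μ) * W) fun ξ => ?_
    rw [norm_mul, norm_mul, Real.norm_eq_abs, Real.norm_eq_abs, Real.norm_eq_abs]
    calc _ ≤ (c * (2 * π) * |ξ| + μ) * (|ξ| * (W * ‖v ξ‖)) := by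
          have := M_bound c μ hc hμ ξ
          have := hbb ξ
          gcongr
      _ = (c * (2 * π) * |ξ| ^ 2 + μ * |ξ|) * (W * ‖v ξ‖) := by ring
      _ ≤ (c * (2 * π) * |ξ| ^ 2 + μ * (1 + |ξ| ^ 2)) * (W * ‖v ξ‖) := by
          have := abs_le_one_add_sq ξ
          gcongr
      _ = _ := by ring

lemma s_integrable (c : ℝ) (hc : 0 < c) (w : SchwartzMap ℝ ℂ) :
    Integrable (fun ξ => ‖w ξ‖ ^ 2) ∧
    Integrable (fun ξ => ‖w ξ‖ ^ 2 / √(c ^ 2 * (2 * π * ξ) ^ 2 + c ^ 4 / 4)) := by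
  obtain ⟨W, hW0, hW⟩ := aux_bdd w
  have hN : Continuous (fun ξ => ‖w ξ‖ ^ 2) := w.continuous.norm.pow 2
  have h0 : ∀ ξ, c ^ 2 / 2 ≤ √(c ^ 2 * (2 * π * ξ) ^ 2 + c ^ 4 / 4) := fun ξ => by
    have := mSym_nonneg c (2 * π * ξ)
    unfold mSym at this
    linarith
  have hc2 : 0 < c ^ 2 / 2 := by positivity
  have i1 : Integrable (fun ξ => ‖w ξ‖ ^ 2) := by
    refine aux_integrable w _ hN W 0 fun ξ => ?_
    rw [Real.norm_of_nonneg (by positivity)]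
    have := hW ξ
    nlinarith [norm_nonneg (w ξ)]
  refine ⟨i1, (i1.div_const (c ^ 2 / 2)).mono' (Continuous.aestronglyMeasurable ?_)
    (Filter.Eventually.of_forall fun ξ => ?_)⟩
  · refine hN.div (by fun_prop) fun ξ => ?_
    have := h0 ξ
    linarith
  · rw [Real.norm_of_nonneg (by positivity)]
    have := h0 ξ
    gcongr

lemma fourier_side (c μ : ℝ) (hc : 0 < c) (hμ : 0 < μ) (w : SchwartzMap ℝ ℂ) :
    (∫ ξ, (mSym c (2 * π * ξ) + μ) * ‖w ξ‖ ^ 2)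
    + ((∫ ξ, mSym c (2 * π * ξ) * ‖w ξ‖ ^ 2) + c ^ 2 / 2 * (∫ ξ, ‖w ξ‖ ^ 2)
      - c ^ 4 / 4 * ∫ ξ, ‖w ξ‖ ^ 2 / √(c ^ 2 * (2 * π * ξ) ^ 2 + c ^ 4 / 4))
    + 2 * ∫ ξ, (mSym c (2 * π * ξ) + μ) * (ξ * inner ℝ (w ξ) (deriv w ξ)) = 0 := by
  obtain ⟨i1, i2⟩ := MN_integrable c μ hc hμ w w (fun a b => ‖a‖ * ‖b‖) (by fun_prop)
    (fun a b => by rw [abs_of_nonneg (by positivity)])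
  obtain ⟨-, i3⟩ := MN_integrable c μ hc hμ w (SchwartzMap.derivCLM ℂ ℂ w)
    (fun a b => inner ℝ a b) (by fun_prop) (fun a b => abs_real_inner_le_norm a b)
  simp only [SchwartzMap.derivCLM_apply] at i3
  simp only [← sq] at i1 i2
  obtain ⟨i4, i5⟩ := s_integrable c hc w
  have i6 : Integrable (fun ξ => mSym c (2 * π * ξ) * ‖w ξ‖ ^ 2) := by
    have := i1.sub (i4.const_mul μ)
    refine this.congr (Filter.Eventually.of_forall fun ξ => ?_)
    simp only [Pi.sub_apply]
    ring
  have hd : ∀ ξ, HasDerivAt (fun ξ => (mSym c (2 * π * ξ) + μ) * (ξ * ‖w ξ‖ ^ 2))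
      (((mSym c (2 * π * ξ) + μ) * ‖w ξ‖ ^ 2 + (mSym c (2 * π * ξ) * ‖w ξ‖ ^ 2
        + c ^ 2 / 2 * ‖w ξ‖ ^ 2
        - c ^ 4 / 4 * (‖w ξ‖ ^ 2 / √(c ^ 2 * (2 * π * ξ) ^ 2 + c ^ 4 / 4))))
        + 2 * ((mSym c (2 * π * ξ) + μ) * (ξ * inner ℝ (w ξ) (deriv w ξ)))) ξ := by
    intro ξ
    have h1 := (mSym_hasDerivAt c ξ hc).add_const μ
    have h2 := (w.differentiableAt (x := ξ)).hasDerivAt.norm_sq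
    have h3 := h1.mul ((hasDerivAt_id ξ).mul h2)
    convert! h3 using 1
    simp only [id, Pi.mul_apply]
    have h0 : 0 < c ^ 2 * (2 * π * ξ) ^ 2 + c ^ 4 / 4 := by positivity
    have hs := Real.sqrt_pos.2 h0
    have hs2 := Real.sq_sqrt h0.le
    have key : c ^ 2 * (2 * π) ^ 2 * ξ / √(c ^ 2 * (2 * π * ξ) ^ 2 + c ^ 4 / 4) * ξ
      = mSym c (2 * π * ξ) + c ^ 2 / 2
        - c ^ 4 / 4 * (1 / √(c ^ 2 * (2 * π * ξ) ^ 2 + c ^ 4 / 4)) := by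
      unfold mSym
      generalize √(c ^ 2 * (2 * π * ξ) ^ 2 + c ^ 4 / 4) = s at hs hs2
      field_simp
      linarith
    linear_combination (-‖w ξ‖ ^ 2) * key
  have j1 := (i6.add (i4.const_mul (c ^ 2 / 2))).sub (i5.const_mul (c ^ 4 / 4))
  have := integral_eq_zero_of_hasDerivAt_of_integrable hd
    ((i1.add j1).add (i3.const_mul 2)) i2
  have t1 := integral_add (i1.add j1) (i3.const_mul 2)
  have t2 := integral_add i1 j1
  have t3 := integral_sub (i6.add (i4.const_mul (c ^ 2 / 2))) (i5.const_mul (c ^ 4 / 4))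
  have t4 := integral_add i6 (i4.const_mul (c ^ 2 / 2))
  simp only [Pi.add_apply, Pi.sub_apply] at t1 t2 t3 t4
  rw [t1, t2, t3, t4, integral_const_mul, integral_const_mul,
    integral_const_mul] at this
  exact this

theorem energy_identity_for_solutions (p c μ : ℝ) (hp : 1 < p) (hc : 0 < c) (hμ : 0 < μ)
    (u : SchwartzMap ℝ ℝ)
    (heq : ∀ ξ : ℝ,
      ((mSym c (2 * π * ξ) + μ : ℝ) : ℂ) * 𝓕 (fun x : ℝ => (u x : ℂ)) ξ
        = 𝓕 (fun x : ℝ => ((|u x| ^ (p - 1) * u x : ℝ) : ℂ)) ξ) :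
    energyC c p (fun x : ℝ => (u x : ℂ))
        = (p - 3) / (2 * (p - 1)) * kineticC c (fun x : ℝ => (u x : ℂ))
          - c ^ 2 / (2 * (p - 1)) * (∫ x : ℝ, |u x| ^ 2)
          + c ^ 4 / (4 * (p - 1)) *
              (∫ ξ : ℝ, ‖𝓕 (fun x : ℝ => (u x : ℂ)) ξ‖ ^ 2
                / Real.sqrt (c ^ 2 * (2 * π * ξ) ^ 2 + c ^ 4 / 4)) ∧
    (3 < p → p < 5 →
      (p - 3) / (2 * (p - 1)) * kineticC c (fun x : ℝ => (u x : ℂ))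
          - c ^ 2 / (2 * (p - 1)) * (∫ x : ℝ, |u x| ^ 2)
        ≤ energyC c p (fun x : ℝ => (u x : ℂ))) := by
  set f : SchwartzMap ℝ ℂ := u.postcompCLM Complex.ofRealCLM with hf
  have hfu : (fun x : ℝ => (u x : ℂ)) = f := rfl
  set w : SchwartzMap ℝ ℂ := 𝓕 f with hw
  have hwu : 𝓕 (fun x : ℝ => (u x : ℂ)) = w := rfl
  have hfd : ∀ x, deriv f x = ((deriv u x : ℝ) : ℂ) := fun x =>
    ((u.differentiableAt (x := x)).hasDerivAt.ofReal_comp).deriv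
  rw [hwu] at heq ⊢
  have hgi : Integrable (fun x : ℝ => ((|u x| ^ (p - 1) * u x : ℝ) : ℂ)) :=
    (g_integrable p hp u).ofReal
  have P : ∀ φ : SchwartzMap ℝ ℂ,
      ∫ ξ, (mSym c (2 * π * ξ) + μ) * inner ℝ (w ξ) ((𝓕 φ : SchwartzMap ℝ ℂ) ξ)
      = ∫ x, (|u x| ^ (p - 1) * u x) * (φ x).re := by
    intro φ
    have h := pairing _ hgi φ
    simp only [← heq] at h
    obtain ⟨Φ, hΦ0, hΦ⟩ := aux_bdd φ
    obtain ⟨i1, -⟩ := MN_integrable c μ hc hμ w (𝓕 φ) (fun a b => ‖a‖ * ‖b‖) (by fun_prop)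
      (fun a b => by rw [abs_of_nonneg (by positivity)])
    have hM : Continuous (fun ξ => mSym c (2 * π * ξ) + μ) :=
      (mSym_continuous c).add continuous_const
    have iL : Integrable (fun ξ => inner ℂ (((mSym c (2 * π * ξ) + μ : ℝ) : ℂ) * w ξ)
        ((𝓕 φ : SchwartzMap ℝ ℂ) ξ)) := by
      refine i1.norm.mono' (Continuous.aestronglyMeasurable ?_)
        (Filter.Eventually.of_forall fun ξ => ?_)
      · exact ((Complex.continuous_ofReal.comp hM).mul w.continuous).inner (𝓕 φ).continuous
      · refine (norm_inner_le_norm _ _).trans (le_of_eq ?_)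
        rw [norm_mul, norm_mul, norm_mul, Complex.norm_real, norm_norm, norm_norm]
        ring
    have iR : Integrable (fun x => inner ℂ ((|u x| ^ (p - 1) * u x : ℝ) : ℂ) (φ x)) := by
      refine (hgi.norm.mul_const Φ).mono'
        (hgi.aestronglyMeasurable.inner φ.continuous.aestronglyMeasurable)
        (Filter.Eventually.of_forall fun x => ?_)
      exact (norm_inner_le_norm _ _).trans (mul_le_mul_of_nonneg_left (hΦ x) (norm_nonneg _))
    have h' := congrArg (RCLike.re : ℂ → ℝ) h
    rw [← integral_re iR] at h'
    have h'' := (integral_re iL).trans h'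
    convert! h'' using 3 with ξ x
    · simp [Complex.inner, RCLike.inner_apply]
      ring
    · simp [RCLike.inner_apply]
      ring
  have hNe : ∫ ξ, (mSym c (2 * π * ξ) + μ) * ‖w ξ‖ ^ 2 = ∫ x, |u x| ^ (p + 1) := by
    have := P f
    simp only [← hw, real_inner_self_eq_norm_sq] at this
    rw [this]
    congr 1 with x
    have e : (f x).re = u x := rfl
    have e2 : |u x| ^ (p + 1) = |u x| ^ (p - 1) * |u x| ^ 2 := by
      rw [← Real.rpow_natCast |u x| 2, ← Real.rpow_add_of_nonneg (abs_nonneg _) (by linarith)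
        (by norm_num)]
      congr 1; push_cast; ring
    rw [e, e2, sq_abs]; ring
  have hPo : -(∫ ξ, (mSym c (2 * π * ξ) + μ) * ‖w ξ‖ ^ 2)
      - ∫ ξ, (mSym c (2 * π * ξ) + μ) * (ξ * inner ℝ (w ξ) (deriv w ξ))
      = - (1 / (p + 1)) * ∫ x, |u x| ^ (p + 1) := by
    rw [← pohozaev_real p hp u]
    have := P (xD f)
    simp only [xD_fourier, xD_apply, hfd, ← hw] at this
    obtain ⟨i1, -⟩ := MN_integrable c μ hc hμ w w (fun a b => ‖a‖ * ‖b‖) (by fun_prop)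
      (fun a b => by rw [abs_of_nonneg (by positivity)])
    obtain ⟨-, i3⟩ := MN_integrable c μ hc hμ w (SchwartzMap.derivCLM ℂ ℂ w)
      (fun a b => inner ℝ a b) (by fun_prop) (fun a b => abs_real_inner_le_norm a b)
    simp only [SchwartzMap.derivCLM_apply] at i3
    simp only [← sq] at i1
    have t1 := integral_sub i1.neg i3
    simp only [Pi.neg_apply] at t1
    rw [← integral_neg, ← t1]
    convert! this using 3 with ξ x
    · rw [inner_sub_right, inner_neg_right, real_inner_self_eq_norm_sq, ← Complex.real_smul,
        real_inner_smul_right]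
      ring
    · rw [← Complex.ofReal_mul, Complex.ofReal_re]
  have hFs := fourier_side c μ hc hμ w
  have hPl : ∫ ξ, ‖w ξ‖ ^ 2 = ∫ x, |u x| ^ 2 := by
    rw [hw, SchwartzMap.integral_norm_sq_fourier]
    congr 1 with x
    have e : f x = (u x : ℂ) := rfl
    rw [e, Complex.norm_real, Real.norm_eq_abs]
  have hT : ∫ x, ‖(u x : ℂ)‖ ^ (p + 1) = ∫ x, |u x| ^ (p + 1) := by
    simp only [Complex.norm_real, Real.norm_eq_abs]
  have hK : kineticC c (fun x : ℝ => (u x : ℂ)) = ∫ ξ, mSym c (2 * π * ξ) * ‖w ξ‖ ^ 2 := rfl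
  have hmain : energyC c p (fun x : ℝ => (u x : ℂ))
        = (p - 3) / (2 * (p - 1)) * kineticC c (fun x : ℝ => (u x : ℂ))
          - c ^ 2 / (2 * (p - 1)) * (∫ x : ℝ, |u x| ^ 2)
          + c ^ 4 / (4 * (p - 1)) *
              (∫ ξ : ℝ, ‖w ξ‖ ^ 2
                / Real.sqrt (c ^ 2 * (2 * π * ξ) ^ 2 + c ^ 4 / 4)) := by
    unfold energyC
    rw [hT, hK]
    rw [hPl, hNe] at hFs
    rw [hNe] at hPo
    generalize (∫ ξ : ℝ, ‖w ξ‖ ^ 2 / Real.sqrt (c ^ 2 * (2 * π * ξ) ^ 2 + c ^ 4 / 4)) = R at *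
    generalize (∫ x, |u x| ^ (p + 1)) = T at *
    generalize (∫ ξ, mSym c (2 * π * ξ) * ‖w ξ‖ ^ 2) = K at *
    generalize (∫ x : ℝ, |u x| ^ 2) = L at *
    generalize (∫ ξ, (mSym c (2 * π * ξ) + μ) * (ξ * inner ℝ (w ξ) (deriv w ξ))) = Q at *
    have h1 : p + 1 ≠ 0 := by linarith
    have h2 : p - 1 ≠ 0 := by linarith
    have hQ : Q = 1 / (p + 1) * T - T := by linarith
    subst hQ
    have h3 : 1 / (p + 1) * T = 1 / (p - 1) * (K + c ^ 2 / 2 * L - c ^ 4 / 4 * R) := by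
      field_simp
      field_simp at hFs
      linarith
    rw [h3]
    field_simp
    ring
  refine ⟨hmain, fun h3 _ => ?_⟩
  rw [hmain]
  have : 0 ≤ c ^ 4 / (4 * (p - 1)) * (∫ ξ : ℝ, ‖w ξ‖ ^ 2
                / Real.sqrt (c ^ 2 * (2 * π * ξ) ^ 2 + c ^ 4 / 4)) := by
    refine mul_nonneg (div_nonneg (by positivity) (by linarith)) (integral_nonneg fun ξ => ?_)
    positivity
  linarith
end
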